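/- Let p be an odd prime number, let γ := −1/(2p) − 1/(4p²) ∈ ℂ_p, and for c ∈ ℂ_p let f_c(z) := z² + c. If c ∈ ℂ_p satisfies |c − γ| < p, then there exists a homeomorphism h : J(f_c) → Σ such that h(f_c(z)) = σ(h(z)) for all z ∈ J(f_c), where Σ is the two-symbol sequence space and σ the shift map. In particular, J(f_c) is compact. -/

import Mathlib

open Polynomial

noncomputable section

/-- The projective line over `K`: `K` together with a point at infinity (`none`). -/
def P1 (K : Type*) := Option K

variable {K : Type*}

/-- Inclusion of `K` into the projective line. -/
def toP1 : K → P1 K := some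

/-- The point at infinity of the projective line. -/
def P1.infty : P1 K := none

/-- The extension of a polynomial map to the projective line, sending `∞` to `∞`. -/
def polyMap [CommRing K] (f : K[X]) : P1 K → P1 K :=
  fun z => Option.map (fun w => f.eval w) z

/-- The chordal metric on the projective line over a normed field. -/
def chordal [NormedField K] (x y : P1 K) : ℝ :=
  match x, y with
  | some z, some w => ‖z - w‖ / (max ‖z‖ 1 * max ‖w‖ 1)
  | some z, none => 1 / max ‖z‖ 1
  | none, some w => 1 / max ‖w‖ 1
  | none, none => 0

/-- A subset of the projective line is `ρ`-open if around each of its points it contains a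
ball with respect to the chordal metric. -/
def IsRhoOpen [NormedField K] (U : Set (P1 K)) : Prop :=
  ∀ x ∈ U, ∃ ε > 0, ∀ y, chordal x y < ε → y ∈ U

/-- The topology on the projective line induced by the chordal metric. -/
instance P1.instTopologicalSpace (K : Type*) [NormedField K] : TopologicalSpace (P1 K) where
  IsOpen := IsRhoOpen
  isOpen_univ := fun _ _ => ⟨1, one_pos, fun _ _ => trivial⟩
  isOpen_inter := fun U V hU hV x hx => by
    obtain ⟨ε₁, hε₁, h₁⟩ := hU x hx.1
    obtain ⟨ε₂, hε₂, h₂⟩ := hV x hx.2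
    exact ⟨min ε₁ ε₂, lt_min hε₁ hε₂, fun y hy =>
      ⟨h₁ y (lt_of_lt_of_le hy (min_le_left _ _)), h₂ y (lt_of_lt_of_le hy (min_le_right _ _))⟩⟩
  isOpen_sUnion := fun S hS x hx => by
    obtain ⟨U, hUS, hxU⟩ := hx
    obtain ⟨ε, hε, h⟩ := hS U hUS x hxU
    exact ⟨ε, hε, fun y hy => ⟨U, hUS, h y hy⟩⟩

/-- The Fatou set of a polynomial map: the largest `ρ`-open subset of the projective line on
which the family of iterates is equicontinuous with respect to the chordal metric. -/
def fatou [NormedField K] (f : K[X]) : Set (P1 K) :=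
  {x | ∃ U : Set (P1 K), x ∈ U ∧ IsRhoOpen U ∧
    ∀ y ∈ U, ∀ ε > 0, ∃ δ > 0, ∀ z : P1 K, chordal y z < δ →
      ∀ n : ℕ, chordal ((polyMap f)^[n] y) ((polyMap f)^[n] z) < ε}

/-- The Julia set of a polynomial map: the complement of the Fatou set. -/
def julia [NormedField K] (f : K[X]) : Set (P1 K) :=
  (fatou f)ᶜ

/-- The dynamics of `f` and `g` on their Julia sets are conjugate: there is a homeomorphism
`h : J(f) → J(g)` with `h ∘ f = g ∘ h` on `J(f)`. -/
def JuliaConjugate [NormedField K] (f g : K[X]) : Prop :=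
  ∃ h : (julia f) ≃ₜ (julia g),
    ∀ (z : P1 K) (hz : z ∈ julia f), ∃ hfz : polyMap f z ∈ julia f,
      (h ⟨polyMap f z, hfz⟩ : P1 K) = polyMap g (h ⟨z, hz⟩)

/-- `min {|l|^{1/(l-1)} : 2 ≤ l ≤ d}` where `|l|` is the `p`-adic absolute value of `l`. -/
def muFactor (p : ℕ) [Fact (Nat.Prime p)] (d : ℕ) : ℝ :=
  sInf {x : ℝ | ∃ l : ℕ, 2 ≤ l ∧ l ≤ d ∧ x = ‖(l : ℚ_[p])‖ ^ ((1 : ℝ) / ((l : ℝ) - 1))}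

/-- The shift map on the two-symbol sequence space `Σ = {0,1}^ℕ`. -/
def shiftMap : (ℕ → Bool) → (ℕ → Bool) := fun s n => s (n + 1)

open Function

section Chordal

theorem P1.eq_infty_or_eq_toP1 (x : P1 K) : x = P1.infty ∨ ∃ z : K, x = toP1 z := by
  rcases x with _ | z
  · exact Or.inl rfl
  · exact Or.inr ⟨z, rfl⟩

theorem toP1_injective : Injective (toP1 : K → P1 K) := Option.some_injective K

theorem toP1_ne_infty (z : K) : toP1 z ≠ P1.infty := Option.some_ne_none z

variable [NormedField K]

theorem chordal_toP1 (z w : K) :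
    chordal (toP1 z) (toP1 w) = ‖z - w‖ / (max ‖z‖ 1 * max ‖w‖ 1) := rfl

theorem chordal_toP1_infty (z : K) : chordal (toP1 z) P1.infty = 1 / max ‖z‖ 1 := rfl

theorem chordal_infty_toP1 (z : K) : chordal P1.infty (toP1 z) = 1 / max ‖z‖ 1 := rfl

theorem chordal_infty_infty : chordal (P1.infty : P1 K) P1.infty = 0 := rfl

theorem polyMap_toP1 (f : K[X]) (z : K) : polyMap f (toP1 z) = toP1 (f.eval z) := rfl

theorem polyMap_infty (f : K[X]) : polyMap f P1.infty = P1.infty := rfl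

theorem polyMap_quadratic_toP1 (c z : K) :
    polyMap (X ^ 2 + C c) (toP1 z) = toP1 (z ^ 2 + c) := by
  simp [polyMap_toP1]

theorem iterate_polyMap_quadratic_toP1 (c z : K) (n : ℕ) :
    (polyMap (X ^ 2 + C c))^[n] (toP1 z) = toP1 ((fun w => w ^ 2 + c)^[n] z) := by
  induction n generalizing z with
  | zero => rfl
  | succ n ih => rw [iterate_succ_apply, iterate_succ_apply, polyMap_quadratic_toP1, ih]

theorem chordal_toP1_le_norm_sub (z w : K) : chordal (toP1 z) (toP1 w) ≤ ‖z - w‖ := by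
  rw [chordal_toP1]
  exact div_le_self (norm_nonneg _)
    (one_le_mul_of_one_le_of_one_le (le_max_right _ _) (le_max_right _ _))

/-- The complement of the closed disc of radius `r` about the origin, together with `∞`. -/
def exteriorDisc (K : Type*) [NormedField K] (r : ℝ) : Set (P1 K) :=
  {x | ∀ w : K, x = toP1 w → r < ‖w‖}

theorem infty_mem_exteriorDisc (r : ℝ) : (P1.infty : P1 K) ∈ exteriorDisc K r :=
  fun w hw => absurd hw.symm (toP1_ne_infty w)

theorem toP1_mem_exteriorDisc {r : ℝ} {z : K} : toP1 z ∈ exteriorDisc K r ↔ r < ‖z‖ :=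
  ⟨fun h => h z rfl, fun h _ hw => toP1_injective hw ▸ h⟩

theorem exists_of_notMem_exteriorDisc {r : ℝ} {x : P1 K} (hx : x ∉ exteriorDisc K r) :
    ∃ z : K, x = toP1 z ∧ ‖z‖ ≤ r := by
  rcases x.eq_infty_or_eq_toP1 with rfl | ⟨z, rfl⟩
  · exact absurd (infty_mem_exteriorDisc r) hx
  · exact ⟨z, rfl, not_lt.1 fun h => hx (toP1_mem_exteriorDisc.2 h)⟩

/-- The closed disc of radius one about `b`. -/
def unitDisc (b : K) : Set (P1 K) := {x | ∃ w : K, x = toP1 w ∧ ‖w - b‖ ≤ 1}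

theorem toP1_mem_unitDisc {b z : K} : toP1 z ∈ unitDisc b ↔ ‖z - b‖ ≤ 1 :=
  ⟨fun ⟨_, hw, h⟩ => toP1_injective hw ▸ h, fun h => ⟨z, rfl, h⟩⟩

variable [IsUltrametricDist K]

theorem norm_eq_of_norm_sub_lt {z w : K} (h : ‖z - w‖ < ‖w‖) : ‖z‖ = ‖w‖ := by
  have := IsUltrametricDist.norm_add_eq_max_of_norm_ne_norm h.ne
  rwa [sub_add_cancel, max_eq_right h.le] at this

theorem norm_sub_le_max (z w : K) : ‖z - w‖ ≤ max ‖z‖ ‖w‖ := by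
  simpa [sub_eq_add_neg] using IsUltrametricDist.norm_add_le_max z (-w)

theorem norm_sub_eq_of_norm_lt {z w : K} (h : ‖w‖ < ‖z‖) : ‖z - w‖ = ‖z‖ := by
  have := IsUltrametricDist.norm_add_eq_max_of_norm_ne_norm (x := z) (y := -w)
    (by rw [norm_neg]; exact h.ne')
  rwa [← sub_eq_add_neg, norm_neg, max_eq_left h.le] at this

theorem norm_add_eq_of_norm_lt {z w : K} (h : ‖w‖ < ‖z‖) : ‖z + w‖ = ‖z‖ := by
  have := IsUltrametricDist.norm_add_eq_max_of_norm_ne_norm h.ne'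
  rwa [max_eq_left h.le] at this

theorem inv_le_chordal {r : ℝ} (hr : 1 < r) {x y : P1 K} (hx : x ∈ exteriorDisc K r)
    (hy : y ∉ exteriorDisc K r) : 1 / r ≤ chordal x y := by
  obtain ⟨w, rfl, hw⟩ := exists_of_notMem_exteriorDisc hy
  have hm : max ‖w‖ 1 ≤ r := max_le hw hr.le
  have hm0 : 0 < max ‖w‖ 1 := lt_max_of_lt_right one_pos
  rcases x.eq_infty_or_eq_toP1 with rfl | ⟨z, rfl⟩
  · rw [chordal_infty_toP1]
    exact one_div_le_one_div_of_le hm0 hm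
  · have hz := toP1_mem_exteriorDisc.1 hx
    have hz0 : ‖z‖ ≠ 0 := by linarith
    rw [chordal_toP1, norm_sub_eq_of_norm_lt (hw.trans_lt hz),
      max_eq_left (hr.trans hz).le, div_mul_eq_div_div, div_self hz0]
    exact one_div_le_one_div_of_le hm0 hm

theorem norm_sub_lt_one_of_chordal_lt {r : ℝ} (hr : 1 < r) {z : K} (hz : ‖z‖ = r) {y : P1 K}
    (h : chordal (toP1 z) y < 1 / r ^ 2) : ∃ w : K, y = toP1 w ∧ ‖z - w‖ < 1 := by
  have hr0 : 0 < r := by linarith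
  have hlt : 1 / r ^ 2 ≤ 1 / r := one_div_le_one_div_of_le hr0 (by nlinarith)
  rcases y.eq_infty_or_eq_toP1 with rfl | ⟨w, rfl⟩
  · rw [chordal_toP1_infty, hz, max_eq_left hr.le] at h
    linarith
  · refine ⟨w, rfl, ?_⟩
    rw [chordal_toP1, hz, max_eq_left hr.le] at h
    rcases lt_or_ge r ‖w‖ with hw | hw
    · rw [norm_sub_rev, norm_sub_eq_of_norm_lt (by rwa [hz]), max_eq_left (hr.trans hw).le,
        div_mul_eq_div_div, div_right_comm, div_self (by linarith)] at h
      linarith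
    · have hm0 : 0 < max ‖w‖ 1 := lt_max_of_lt_right one_pos
      have hm : max ‖w‖ 1 ≤ r := max_le hw hr.le
      rw [div_lt_div_iff₀ (by positivity) (by positivity)] at h
      nlinarith

theorem isRhoOpen_unitDisc {b : K} (hb : 1 < ‖b‖) : IsRhoOpen (unitDisc b) := by
  rintro _ ⟨z, rfl, hz⟩
  have hzb : ‖z‖ = ‖b‖ := norm_eq_of_norm_sub_lt (hz.trans_lt hb)
  refine ⟨1 / ‖b‖ ^ 2, by positivity, fun y hy => ?_⟩
  obtain ⟨w, rfl, hw⟩ := norm_sub_lt_one_of_chordal_lt hb hzb hy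
  refine toP1_mem_unitDisc.2 ?_
  have := IsUltrametricDist.norm_add_le_max (w - z) (z - b)
  rw [sub_add_sub_cancel, norm_sub_rev w z] at this
  exact this.trans (max_le hw.le hz)

end Chordal

section Quadratic

variable [NormedField K] [IsUltrametricDist K] {r : ℝ} {c : K}

theorem norm_sq_add_eq_of_lt (hr : 1 < r) (hc : ‖c‖ = r ^ 2) {z : K} (hz : r < ‖z‖) :
    ‖z ^ 2 + c‖ = ‖z‖ ^ 2 := by
  rw [norm_add_eq_of_norm_lt, norm_pow]
  rw [norm_pow, hc]
  nlinarith

theorem norm_eq_of_norm_sq_add_le (hr : 1 < r) (hc : ‖c‖ = r ^ 2) {z : K} (hz : ‖z‖ ≤ r)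
    (hz' : ‖z ^ 2 + c‖ ≤ r) : ‖z‖ = r := by
  by_contra hne
  have hlt : ‖z‖ < r := lt_of_le_of_ne hz hne
  rw [add_comm, norm_add_eq_of_norm_lt, hc] at hz'
  · nlinarith
  · rw [norm_pow, hc]
    nlinarith [norm_nonneg z]

theorem sq_max_norm_le (hr : 1 < r) (hc : ‖c‖ = r ^ 2) (z : K) :
    max ‖z‖ 1 ^ 2 ≤ r ^ 2 * max ‖z ^ 2 + c‖ 1 := by
  rcases lt_or_ge r ‖z‖ with hz | hz
  · rw [norm_sq_add_eq_of_lt hr hc hz, max_eq_left (hr.trans hz).le]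
    have h1 : ‖z‖ ^ 2 ≤ max (‖z‖ ^ 2) 1 := le_max_left _ _
    exact h1.trans (le_mul_of_one_le_left (by positivity) (one_le_pow₀ hr.le))
  · have h1 : max ‖z‖ 1 ≤ r := max_le hz hr.le
    have h0 : 1 ≤ max ‖z‖ 1 := le_max_right _ _
    have h2 : 1 ≤ max ‖z ^ 2 + c‖ 1 := le_max_right _ _
    nlinarith [sq_nonneg r]

theorem chordal_polyMap_le (hr : 1 < r) (hc : ‖c‖ = r ^ 2) (x y : P1 K) :
    chordal (polyMap (X ^ 2 + C c) x) (polyMap (X ^ 2 + C c) y) ≤ r ^ 4 * chordal x y := by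
  have key : ∀ z : K, 1 / max ‖z ^ 2 + c‖ 1 ≤ r ^ 4 * (1 / max ‖z‖ 1) := fun z => by
    have h0 : 1 ≤ max ‖z‖ 1 := le_max_right _ _
    have h2 : 1 ≤ max ‖z ^ 2 + c‖ 1 := le_max_right _ _
    have h := sq_max_norm_le hr hc z
    have h4 : r ^ 2 ≤ r ^ 4 := pow_le_pow_right₀ hr.le (by norm_num)
    rw [mul_one_div, div_le_div_iff₀ (by positivity) (by positivity)]
    nlinarith
  rcases x.eq_infty_or_eq_toP1 with rfl | ⟨z, rfl⟩ <;>
    rcases y.eq_infty_or_eq_toP1 with rfl | ⟨w, rfl⟩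
  · simp [polyMap_infty, chordal_infty_infty]
  · simpa only [polyMap_infty, polyMap_quadratic_toP1, chordal_infty_toP1] using key w
  · simpa only [polyMap_infty, polyMap_quadratic_toP1, chordal_toP1_infty] using key z
  · rw [polyMap_quadratic_toP1, polyMap_quadratic_toP1, chordal_toP1, chordal_toP1]
    have hz0 : 1 ≤ max ‖z‖ 1 := le_max_right _ _
    have hw0 : 1 ≤ max ‖w‖ 1 := le_max_right _ _
    have hz1 : 1 ≤ max ‖z ^ 2 + c‖ 1 := le_max_right _ _
    have hw1 : 1 ≤ max ‖w ^ 2 + c‖ 1 := le_max_right _ _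
    have hz := sq_max_norm_le hr hc z
    have hw := sq_max_norm_le hr hc w
    have hadd : ‖z + w‖ ≤ max ‖z‖ 1 * max ‖w‖ 1 := by
      refine (IsUltrametricDist.norm_add_le_max z w).trans (max_le ?_ ?_)
      · exact (le_max_left _ _).trans (le_mul_of_one_le_right (by positivity) hw0)
      · exact (le_max_left _ _).trans (le_mul_of_one_le_left (by positivity) hz0)
    have hfac : z ^ 2 + c - (w ^ 2 + c) = (z - w) * (z + w) := by ring
    rw [hfac, norm_mul, ← mul_div_assoc, div_le_div_iff₀ (by positivity) (by positivity)]
    calc ‖z - w‖ * ‖z + w‖ * (max ‖z‖ 1 * max ‖w‖ 1)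
        ≤ ‖z - w‖ * (max ‖z‖ 1 * max ‖w‖ 1) * (max ‖z‖ 1 * max ‖w‖ 1) := by gcongr
      _ = ‖z - w‖ * (max ‖z‖ 1 ^ 2 * max ‖w‖ 1 ^ 2) := by ring
      _ ≤ ‖z - w‖ * ((r ^ 2 * max ‖z ^ 2 + c‖ 1) * (r ^ 2 * max ‖w ^ 2 + c‖ 1)) := by gcongr
      _ = r ^ 4 * ‖z - w‖ * (max ‖z ^ 2 + c‖ 1 * max ‖w ^ 2 + c‖ 1) := by ring

theorem chordal_iterate_polyMap_le (hr : 1 < r) (hc : ‖c‖ = r ^ 2) (x y : P1 K) (n : ℕ) :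
    chordal ((polyMap (X ^ 2 + C c))^[n] x) ((polyMap (X ^ 2 + C c))^[n] y) ≤
      (r ^ 4) ^ n * chordal x y := by
  induction n with
  | zero => simp
  | succ n ih =>
    rw [iterate_succ_apply', iterate_succ_apply', pow_succ' (r ^ 4), mul_assoc]
    exact (chordal_polyMap_le hr hc _ _).trans (by gcongr)

theorem polyMap_mem_exteriorDisc (hr : 1 < r) (hc : ‖c‖ = r ^ 2) {x : P1 K}
    (hx : x ∈ exteriorDisc K r) : polyMap (X ^ 2 + C c) x ∈ exteriorDisc K r := by
  rcases x.eq_infty_or_eq_toP1 with rfl | ⟨z, rfl⟩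
  · exact infty_mem_exteriorDisc r
  · have hz := toP1_mem_exteriorDisc.1 hx
    rw [polyMap_quadratic_toP1, toP1_mem_exteriorDisc, norm_sq_add_eq_of_lt hr hc hz]
    nlinarith

theorem chordal_polyMap_le_of_mem_exteriorDisc (hr : 1 < r) (hc : ‖c‖ = r ^ 2) {x y : P1 K}
    (hx : x ∈ exteriorDisc K r) (hy : y ∈ exteriorDisc K r) :
    chordal (polyMap (X ^ 2 + C c) x) (polyMap (X ^ 2 + C c) y) ≤ chordal x y := by
  have key : ∀ z : K, r < ‖z‖ → 1 / max ‖z ^ 2 + c‖ 1 ≤ 1 / max ‖z‖ 1 := fun z hz => by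
    rw [norm_sq_add_eq_of_lt hr hc hz]
    refine one_div_le_one_div_of_le (by positivity) (max_le_max ?_ le_rfl)
    nlinarith
  rcases x.eq_infty_or_eq_toP1 with rfl | ⟨z, rfl⟩ <;>
    rcases y.eq_infty_or_eq_toP1 with rfl | ⟨w, rfl⟩
  · exact le_rfl
  · simpa only [polyMap_infty, polyMap_quadratic_toP1, chordal_infty_toP1] using
      key w (toP1_mem_exteriorDisc.1 hy)
  · simpa only [polyMap_infty, polyMap_quadratic_toP1, chordal_toP1_infty] using
      key z (toP1_mem_exteriorDisc.1 hx)
  · have hz := toP1_mem_exteriorDisc.1 hx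
    have hw := toP1_mem_exteriorDisc.1 hy
    have hz1 : 1 < ‖z‖ := hr.trans hz
    have hw1 : 1 < ‖w‖ := hr.trans hw
    have hadd : ‖z + w‖ ≤ ‖z‖ * ‖w‖ :=
      (IsUltrametricDist.norm_add_le_max z w).trans (max_le (by nlinarith) (by nlinarith))
    have hfac : z ^ 2 + c - (w ^ 2 + c) = (z - w) * (z + w) := by ring
    rw [polyMap_quadratic_toP1, polyMap_quadratic_toP1, chordal_toP1, chordal_toP1, hfac,
      norm_mul, norm_sq_add_eq_of_lt hr hc hz, norm_sq_add_eq_of_lt hr hc hw,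
      max_eq_left hz1.le, max_eq_left hw1.le, max_eq_left (by nlinarith),
      max_eq_left (by nlinarith), div_le_div_iff₀ (by positivity) (by positivity)]
    calc ‖z - w‖ * ‖z + w‖ * (‖z‖ * ‖w‖)
        ≤ ‖z - w‖ * (‖z‖ * ‖w‖) * (‖z‖ * ‖w‖) := by gcongr
      _ = ‖z - w‖ * (‖z‖ ^ 2 * ‖w‖ ^ 2) := by ring

theorem chordal_iterate_polyMap_le_of_mem_exteriorDisc (hr : 1 < r) (hc : ‖c‖ = r ^ 2)
    {x y : P1 K} (hx : x ∈ exteriorDisc K r) (hy : y ∈ exteriorDisc K r) (n : ℕ) :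
    chordal ((polyMap (X ^ 2 + C c))^[n] x) ((polyMap (X ^ 2 + C c))^[n] y) ≤ chordal x y := by
  induction n generalizing x y with
  | zero => exact le_rfl
  | succ n ih =>
    exact (ih (polyMap_mem_exteriorDisc hr hc hx) (polyMap_mem_exteriorDisc hr hc hy)).trans
      (chordal_polyMap_le_of_mem_exteriorDisc hr hc hx hy)

/-- The norm scales by the factor `r` near points of norm `r`. -/
theorem norm_quadratic_sub (hr : 1 < r) (h2 : ‖(2 : K)‖ = 1) {z w : K} (hz : ‖z‖ = r)
    (hzw : ‖z - w‖ ≤ 1) : ‖z ^ 2 + c - (w ^ 2 + c)‖ = r * ‖z - w‖ := by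
  have h : ‖z + w‖ = r := by
    have h2z : ‖2 * z‖ = r := by rw [norm_mul, h2, one_mul, hz]
    rw [show z + w = 2 * z - (z - w) by ring, norm_sub_eq_of_norm_lt (by linarith), h2z]
  rw [show z ^ 2 + c - (w ^ 2 + c) = (z + w) * (z - w) by ring, norm_mul, h]

theorem mem_fatou_of_iterate_mem_exteriorDisc (hr : 1 < r) (hc : ‖c‖ = r ^ 2) {x : P1 K} {n : ℕ}
    (hx : (polyMap (X ^ 2 + C c))^[n] x ∈ exteriorDisc K r) : x ∈ fatou (X ^ 2 + C c) := by
  have near : ∀ {N : ℕ} {y z : P1 K} {η : ℝ}, chordal y z < η / (r ^ 4) ^ N → ∀ m ≤ N,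
      0 < η → chordal ((polyMap (X ^ 2 + C c))^[m] y) ((polyMap (X ^ 2 + C c))^[m] z) < η := by
    intro N y z η h m hm hη
    have hpow : (r ^ 4) ^ m ≤ (r ^ 4) ^ N := pow_le_pow_right₀ (one_le_pow₀ hr.le) hm
    have hN : 0 < (r ^ 4) ^ N := by positivity
    have hm0 : 0 < (r ^ 4) ^ m := by positivity
    rw [lt_div_iff₀ hN] at h
    refine (chordal_iterate_polyMap_le hr hc y z m).trans_lt ?_
    rcases le_or_gt (chordal y z) 0 with h0 | h0
    · exact (mul_nonpos_of_nonneg_of_nonpos hm0.le h0).trans_lt hη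
    · nlinarith
  have stay : ∀ {N : ℕ} {y z : P1 K}, (polyMap (X ^ 2 + C c))^[N] y ∈ exteriorDisc K r →
      chordal y z < 1 / r / (r ^ 4) ^ N → (polyMap (X ^ 2 + C c))^[N] z ∈ exteriorDisc K r := by
    intro N y z hy h
    by_contra hz
    exact absurd (near h N le_rfl (by positivity)) (not_lt.2 (inv_le_chordal hr hy hz))
  refine ⟨{y | (polyMap (X ^ 2 + C c))^[n] y ∈ exteriorDisc K r}, hx, fun y hy =>
    ⟨1 / r / (r ^ 4) ^ n, by positivity, fun z hz => stay hy hz⟩, fun y hy ε hε =>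
    ⟨min ε (1 / r) / (r ^ 4) ^ n, by positivity, fun z hz m => ?_⟩⟩
  have hη : 0 < min ε (1 / r) := by positivity
  rcases le_total m n with hm | hm
  · exact (near hz m hm hη).trans_le (min_le_left _ _)
  · have hzn : (polyMap (X ^ 2 + C c))^[n] z ∈ exteriorDisc K r :=
      stay hy (hz.trans_le (by gcongr; exact min_le_right _ _))
    obtain ⟨k, rfl⟩ := Nat.exists_eq_add_of_le' hm
    rw [iterate_add_apply, iterate_add_apply]
    exact (chordal_iterate_polyMap_le_of_mem_exteriorDisc hr hc hy hzn k).trans_lt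
      ((near hz n le_rfl hη).trans_le (min_le_left _ _))

theorem norm_iterate_eq (hr : 1 < r) (hc : ‖c‖ = r ^ 2) {z : K}
    (hz : ∀ n, ‖(fun w => w ^ 2 + c)^[n] z‖ ≤ r) (n : ℕ) :
    ‖(fun w => w ^ 2 + c)^[n] z‖ = r := by
  have h := hz (n + 1)
  rw [iterate_succ_apply'] at h
  exact norm_eq_of_norm_sq_add_le hr hc (hz n) h

theorem toP1_mem_julia (hr : 1 < r) (hc : ‖c‖ = r ^ 2) (h2 : ‖(2 : K)‖ = 1) {z : K}
    (hz : ∀ n, ‖(fun w => w ^ 2 + c)^[n] z‖ ≤ r) : toP1 z ∈ julia (X ^ 2 + C c) := by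
  rintro ⟨U, hzU, -, hU⟩
  obtain ⟨δ, hδ, h⟩ := hU _ hzU (1 / r ^ 2) (by positivity)
  have hc1 : 1 < ‖c‖ := by rw [hc]; exact one_lt_pow₀ hr two_ne_zero
  obtain ⟨k, hk⟩ := exists_pow_lt_of_lt_one hδ (inv_lt_one_of_one_lt₀ hc1)
  have hc0 : c ≠ 0 := norm_pos_iff.1 (by linarith)
  obtain ⟨w, hwz, hw⟩ : ∃ w, z - w ≠ 0 ∧ ‖z - w‖ < δ := by
    refine ⟨z - c⁻¹ ^ k, ?_, ?_⟩
    · rw [sub_sub_cancel]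
      exact pow_ne_zero _ (inv_ne_zero hc0)
    · rwa [sub_sub_cancel, norm_pow, norm_inv]
  have close : ∀ n, ‖(fun w => w ^ 2 + c)^[n] z - (fun w => w ^ 2 + c)^[n] w‖ < 1 := fun n => by
    have hn := h (toP1 w) ((chordal_toP1_le_norm_sub z w).trans_lt hw) n
    rw [iterate_polyMap_quadratic_toP1, iterate_polyMap_quadratic_toP1] at hn
    obtain ⟨v, hv, hlt⟩ := norm_sub_lt_one_of_chordal_lt hr (norm_iterate_eq hr hc hz n) hn
    rwa [toP1_injective hv]
  have expand : ∀ n, ‖(fun w => w ^ 2 + c)^[n] z - (fun w => w ^ 2 + c)^[n] w‖ =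
      r ^ n * ‖z - w‖ := fun n => by
    induction n with
    | zero => simp
    | succ n ih =>
      rw [iterate_succ_apply', iterate_succ_apply',
        norm_quadratic_sub hr h2 (norm_iterate_eq hr hc hz n) (close n).le, ih]
      ring
  have hpos : 0 < ‖z - w‖ := norm_pos_iff.2 hwz
  obtain ⟨n, hn⟩ := pow_unbounded_of_one_lt (1 / ‖z - w‖) hr
  have hlt := close n
  rw [expand n] at hlt
  rw [div_lt_iff₀ hpos] at hn
  linarith

/-- The Julia set consists of the points with bounded orbit. -/
theorem mem_julia_quadratic_iff (hr : 1 < r) (hc : ‖c‖ = r ^ 2) (h2 : ‖(2 : K)‖ = 1) {x : P1 K} :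
    x ∈ julia (X ^ 2 + C c) ↔
      ∃ z : K, x = toP1 z ∧ ∀ n, ‖(fun w => w ^ 2 + c)^[n] z‖ ≤ r := by
  refine ⟨fun hx => ?_, fun ⟨z, hz, h⟩ => hz ▸ toP1_mem_julia hr hc h2 h⟩
  have hout : ∀ n, (polyMap (X ^ 2 + C c))^[n] x ∉ exteriorDisc K r :=
    fun n hn => hx (mem_fatou_of_iterate_mem_exteriorDisc hr hc hn)
  obtain ⟨z, rfl, -⟩ := exists_of_notMem_exteriorDisc (hout 0)
  refine ⟨z, rfl, fun n => not_lt.1 fun hn => hout n ?_⟩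
  rwa [iterate_polyMap_quadratic_toP1, toP1_mem_exteriorDisc]

end Quadratic

section Coding

variable [NormedField K]

/-- The square root of `β ^ 2` labelled by a bit. -/
def signedRoot (β : K) (b : Bool) : K := if b then β else -β

theorem norm_signedRoot (β : K) (b : Bool) : ‖signedRoot β b‖ = ‖β‖ := by
  cases b <;> simp [signedRoot]

theorem signedRoot_not (β : K) (b : Bool) : signedRoot β (!b) = -signedRoot β b := by
  cases b <;> simp [signedRoot]

open Classical in
/-- The sequence of bits recording which of the two discs contains each iterate. -/
def itinerary (β : K) (x : P1 K) : ℕ → Bool :=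
  fun n => decide ((polyMap (X ^ 2 + C (-β ^ 2)))^[n] x ∈ unitDisc β)

theorem itinerary_polyMap (β : K) (x : P1 K) :
    itinerary β (polyMap (X ^ 2 + C (-β ^ 2)) x) = shiftMap (itinerary β x) := rfl

variable [IsUltrametricDist K] {r : ℝ} {β : K}

theorem eq_of_norm_sub_signedRoot_le (hr : 1 < r) (hβ : ‖β‖ = r) (h2 : ‖(2 : K)‖ = 1) {z : K}
    {a b : Bool} (ha : ‖z - signedRoot β a‖ ≤ 1) (hb : ‖z - signedRoot β b‖ ≤ 1) : a = b := by
  by_contra hab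
  obtain rfl : b = !a := by cases a <;> cases b <;> simp_all
  have h := norm_sub_le_max (z - signedRoot β (!a)) (z - signedRoot β a)
  rw [signedRoot_not, show z - -signedRoot β a - (z - signedRoot β a) = 2 * signedRoot β a by ring,
    norm_mul, h2, one_mul, norm_signedRoot, hβ, ← signedRoot_not] at h
  exact absurd (h.trans (max_le hb ha)) (not_le.2 hr)

theorem exists_norm_sub_signedRoot_le (hβ : ‖β‖ = r) (h2 : ‖(2 : K)‖ = 1) {z : K}
    (hz : ‖z ^ 2 + -β ^ 2‖ ≤ r) : ∃ b, ‖z - signedRoot β b‖ ≤ 1 := by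
  by_contra! h
  have ht := h true
  have hf := h false
  simp only [signedRoot, if_true, Bool.false_eq_true, if_false, sub_neg_eq_add] at ht hf
  rw [show z ^ 2 + -β ^ 2 = (z - β) * (z + β) by ring, norm_mul] at hz
  have hm := norm_sub_le_max (z + β) (z - β)
  rw [show z + β - (z - β) = 2 * β by ring, norm_mul, h2, one_mul, hβ] at hm
  rcases le_max_iff.1 hm with hm | hm <;> nlinarith

/-- Each closed disc about a square root of `β ^ 2` contains a preimage of each small point. -/
theorem exists_preimage [IsAlgClosed K] (hβ : ‖β‖ = r) (h2 : ‖(2 : K)‖ = 1) (b : Bool)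
    {y : K} (hy : ‖y‖ ≤ r) : ∃ z, z ^ 2 + -β ^ 2 = y ∧ ‖z - signedRoot β b‖ ≤ 1 := by
  obtain ⟨z, hz⟩ := IsAlgClosed.exists_pow_nat_eq (y + β ^ 2) two_pos
  obtain ⟨a, ha⟩ := exists_norm_sub_signedRoot_le hβ h2 (z := z) (by rw [hz]; simpa using hy)
  by_cases hab : a = b
  · exact ⟨z, by rw [hz]; ring, hab ▸ ha⟩
  · obtain rfl : b = !a := by cases a <;> cases b <;> simp_all
    refine ⟨-z, by rw [neg_sq, hz]; ring, ?_⟩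
    rwa [signedRoot_not, ← neg_sub', norm_neg]

theorem norm_sub_le_one_of_signedRoot {b : Bool} {z w : K} (hz : ‖z - signedRoot β b‖ ≤ 1)
    (hw : ‖w - signedRoot β b‖ ≤ 1) : ‖z - w‖ ≤ 1 := by
  have h := norm_sub_le_max (z - signedRoot β b) (w - signedRoot β b)
  rw [sub_sub_sub_cancel_right] at h
  exact h.trans (max_le hz hw)

theorem norm_eq_of_signedRoot (hr : 1 < r) (hβ : ‖β‖ = r) {b : Bool} {z : K}
    (hz : ‖z - signedRoot β b‖ ≤ 1) : ‖z‖ = r := by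
  rw [← hβ, ← norm_signedRoot β b]
  refine norm_eq_of_norm_sub_lt (hz.trans_lt ?_)
  rwa [norm_signedRoot, hβ]

/-- Every sequence is the itinerary of a point, compatibly with the shift. -/
theorem exists_coding [IsAlgClosed K] [CompleteSpace K] (hr : 1 < r) (hβ : ‖β‖ = r)
    (h2 : ‖(2 : K)‖ = 1) : ∃ g : (ℕ → Bool) → K, ∀ s,
      g s ^ 2 + -β ^ 2 = g (shiftMap s) ∧ ‖g s - signedRoot β (s 0)‖ ≤ 1 := by
  choose! B hB hB' using fun (b : Bool) (y : K) => exists_preimage hβ h2 b (y := y)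
  let G : ℕ → (ℕ → Bool) → K :=
    fun n => Nat.rec (fun _ => 0) (fun _ φ s => B (s 0) (φ (shiftMap s))) n
  have hG : ∀ n s, G (n + 1) s = B (s 0) (G n (shiftMap s)) := fun _ _ => rfl
  have hle : ∀ n s, ‖G n s‖ ≤ r := fun n => by
    induction n with
    | zero => intro s; simpa [G] using (zero_lt_one.trans hr).le
    | succ n ih =>
      intro s
      rw [hG]
      exact (norm_eq_of_signedRoot hr hβ (hB' (s 0) _ (ih _))).le
  have hsq : ∀ n s, G (n + 1) s ^ 2 + -β ^ 2 = G n (shiftMap s) :=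
    fun n s => hB _ _ (hle n _)
  have hdisc : ∀ n s, ‖G (n + 1) s - signedRoot β (s 0)‖ ≤ 1 := fun n s => hB' _ _ (hle n _)
  have hcauchy : ∀ n s, ‖G n s - G (n + 1) s‖ ≤ r * r⁻¹ ^ n := fun n => by
    induction n with
    | zero => intro s; simpa [G] using hle 1 s
    | succ n ih =>
      intro s
      have h := norm_quadratic_sub (c := -β ^ 2) hr h2 (norm_eq_of_signedRoot hr hβ (hdisc n s))
        (norm_sub_le_one_of_signedRoot (hdisc n s) (hdisc (n + 1) s))
      rw [hsq n, hsq (n + 1)] at h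
      have hn := ih (shiftMap s)
      rw [h] at hn
      have := le_of_mul_le_mul_left hn (zero_lt_one.trans hr)
      rwa [pow_succ', ← mul_assoc, mul_inv_cancel₀ (by linarith), one_mul]
  have hlim : ∀ s, ∃ l, Filter.Tendsto (fun n => G n s) Filter.atTop (nhds l) := fun s =>
    cauchySeq_tendsto_of_complete (cauchySeq_of_le_geometric r⁻¹ r (inv_lt_one_of_one_lt₀ hr)
      fun n => by rw [dist_eq_norm]; exact hcauchy n s)
  choose g hg using hlim
  refine ⟨g, fun s => ⟨?_, ?_⟩⟩
  · have h1 := (((hg s).comp (Filter.tendsto_add_atTop_nat 1)).pow 2).add_const (-β ^ 2)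
    exact tendsto_nhds_unique (h1.congr fun n => hsq n s) (hg (shiftMap s))
  · have h1 := (((hg s).comp (Filter.tendsto_add_atTop_nat 1)).sub_const
      (signedRoot β (s 0))).norm
    exact le_of_tendsto' h1 fun n => hdisc n s

theorem norm_sub_le_of_itinerary_eq (hr : 1 < r) (hβ : ‖β‖ = r) (h2 : ‖(2 : K)‖ = 1)
    {s t : ℕ → Bool} {z w : K}
    (hz : ∀ n, ‖(fun w => w ^ 2 + -β ^ 2)^[n] z - signedRoot β (s n)‖ ≤ 1)
    (hw : ∀ n, ‖(fun w => w ^ 2 + -β ^ 2)^[n] w - signedRoot β (t n)‖ ≤ 1)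
    {n : ℕ} (hst : ∀ i ≤ n, s i = t i) : ‖z - w‖ ≤ r⁻¹ ^ n := by
  induction n generalizing s t z w with
  | zero =>
    have h := hw 0
    rw [← hst 0 le_rfl] at h
    simpa using norm_sub_le_one_of_signedRoot (hz 0) h
  | succ n ih =>
    have h0 : ‖z - w‖ ≤ 1 := by
      have h := hw 0
      rw [← hst 0 (Nat.zero_le _)] at h
      exact norm_sub_le_one_of_signedRoot (hz 0) h
    have h := ih (s := fun i => s (i + 1)) (t := fun i => t (i + 1)) (z := z ^ 2 + -β ^ 2)
      (w := w ^ 2 + -β ^ 2) (fun i => hz (i + 1)) (fun i => hw (i + 1))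
      (fun i hi => hst (i + 1) (by omega))
    have hzr : ‖z‖ = r := norm_eq_of_signedRoot hr hβ (hz 0)
    rw [norm_quadratic_sub hr h2 hzr h0] at h
    rw [pow_succ', inv_mul_eq_div, le_div_iff₀ (by linarith)]
    linarith

theorem itinerary_toP1_eq (hr : 1 < r) (hβ : ‖β‖ = r) (h2 : ‖(2 : K)‖ = 1) {z : K} {n : ℕ}
    {b : Bool} (hz : ‖(fun w => w ^ 2 + -β ^ 2)^[n] z - signedRoot β b‖ ≤ 1) :
    itinerary β (toP1 z) n = b := by
  have h : itinerary β (toP1 z) n = true ↔ b = true := by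
    simp only [itinerary, decide_eq_true_iff]
    rw [iterate_polyMap_quadratic_toP1, toP1_mem_unitDisc]
    refine ⟨fun h => eq_of_norm_sub_signedRoot_le hr hβ h2 hz (by simpa [signedRoot] using h), ?_⟩
    rintro rfl
    simpa [signedRoot] using hz
  exact Bool.eq_iff_iff.2 h

theorem norm_iterate_sub_signedRoot_itinerary_le (hr : 1 < r) (hβ : ‖β‖ = r) (h2 : ‖(2 : K)‖ = 1)
    {z : K} (hz : ∀ n, ‖(fun w => w ^ 2 + -β ^ 2)^[n] z‖ ≤ r) (n : ℕ) :
    ‖(fun w => w ^ 2 + -β ^ 2)^[n] z - signedRoot β (itinerary β (toP1 z) n)‖ ≤ 1 := by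
  have h := hz (n + 1)
  rw [iterate_succ_apply'] at h
  obtain ⟨b, hb⟩ := exists_norm_sub_signedRoot_le hβ h2 h
  rwa [itinerary_toP1_eq hr hβ h2 hb]

theorem isRhoOpen_preimage_iterate {c : K} (hr : 1 < r) (hc : ‖c‖ = r ^ 2) {U : Set (P1 K)}
    (hU : IsRhoOpen U) (n : ℕ) : IsRhoOpen ((polyMap (X ^ 2 + C c))^[n] ⁻¹' U) := by
  intro x hx
  obtain ⟨ε, hε, h⟩ := hU _ hx
  refine ⟨ε / (r ^ 4) ^ n, by positivity, fun y hy => h _ ?_⟩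
  rw [lt_div_iff₀ (by positivity)] at hy
  exact (chordal_iterate_polyMap_le hr hc x y n).trans_lt (by linarith)

theorem continuous_itinerary (hr : 1 < r) (hβ : ‖β‖ = r) (h2 : ‖(2 : K)‖ = 1) :
    Continuous fun x : julia (X ^ 2 + C (-β ^ 2)) => itinerary β (x : P1 K) := by
  have hc : ‖-β ^ 2‖ = r ^ 2 := by rw [norm_neg, norm_pow, hβ]
  refine continuous_pi fun n => continuous_discrete_rng.2 fun b => ?_
  refine ⟨_, isRhoOpen_preimage_iterate hr hc
    (isRhoOpen_unitDisc (b := signedRoot β b) (by rwa [norm_signedRoot, hβ])) n, ?_⟩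
  ext ⟨x, hx⟩
  obtain ⟨z, rfl, hz⟩ := (mem_julia_quadratic_iff hr hc h2).1 hx
  simp only [Set.mem_preimage, Set.mem_singleton_iff, iterate_polyMap_quadratic_toP1,
    toP1_mem_unitDisc]
  refine ⟨itinerary_toP1_eq hr hβ h2, ?_⟩
  rintro rfl
  exact norm_iterate_sub_signedRoot_itinerary_le hr hβ h2 hz n

theorem exists_homeomorph_itinerary [IsAlgClosed K] [CompleteSpace K] (hr : 1 < r) (hβ : ‖β‖ = r)
    (h2 : ‖(2 : K)‖ = 1) : ∃ h : julia (X ^ 2 + C (-β ^ 2)) ≃ₜ (ℕ → Bool),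
      ∀ x, h x = itinerary β (x : P1 K) := by
  have hc : ‖-β ^ 2‖ = r ^ 2 := by rw [norm_neg, norm_pow, hβ]
  have hr0 : 0 < r := zero_lt_one.trans hr
  have hr1 : r⁻¹ < 1 := inv_lt_one_of_one_lt₀ hr
  obtain ⟨g, hg⟩ := exists_coding hr hβ h2
  have hgn : ∀ n s, ‖(fun w => w ^ 2 + -β ^ 2)^[n] (g s) - signedRoot β (s n)‖ ≤ 1 := fun n => by
    induction n with
    | zero => exact fun s => (hg s).2
    | succ n ih =>
      intro s
      rw [iterate_succ_apply, (hg s).1]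
      exact ih (shiftMap s)
  have hgJ : ∀ s, toP1 (g s) ∈ julia (X ^ 2 + C (-β ^ 2)) := fun s =>
    toP1_mem_julia hr hc h2 fun n => (norm_eq_of_signedRoot hr hβ (hgn n s)).le
  refine ⟨⟨⟨fun x => itinerary β (x : P1 K), fun s => ⟨toP1 (g s), hgJ s⟩, ?_, ?_⟩,
    continuous_itinerary hr hβ h2, ?_⟩, fun _ => rfl⟩
  · rintro ⟨x, hx⟩
    obtain ⟨z, rfl, hz⟩ := (mem_julia_quadratic_iff hr hc h2).1 hx
    have hle : ∀ n : ℕ, ‖g (itinerary β (toP1 z)) - z‖ ≤ r⁻¹ ^ n := fun n =>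
      norm_sub_le_of_itinerary_eq hr hβ h2 (fun n => hgn n _)
        (norm_iterate_sub_signedRoot_itinerary_le hr hβ h2 hz) fun _ _ => rfl
    have h0 : ‖g (itinerary β (toP1 z)) - z‖ ≤ 0 :=
      ge_of_tendsto' (tendsto_pow_atTop_nhds_zero_of_lt_one (inv_pos.2 hr0).le hr1) hle
    exact Subtype.ext (congrArg toP1 (sub_eq_zero.1 (norm_le_zero_iff.1 h0)))
  · exact fun s => funext fun n => itinerary_toP1_eq hr hβ h2 (hgn n s)
  · refine Continuous.subtype_mk ⟨fun U hU => isOpen_iff_mem_nhds.2 fun s hs => ?_⟩ _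
    obtain ⟨ε, hε, h⟩ := hU _ hs
    obtain ⟨n, hn⟩ := exists_pow_lt_of_lt_one hε hr1
    refine Filter.mem_of_superset ((PiNat.isOpen_cylinder (fun _ => Bool) s (n + 1)).mem_nhds
      (PiNat.self_mem_cylinder s (n + 1))) fun t ht => h _ ?_
    refine ((chordal_toP1_le_norm_sub _ _).trans ?_).trans_lt hn
    exact norm_sub_le_of_itinerary_eq hr hβ h2 (fun n => hgn n s) (fun n => hgn n t)
      fun i hi => (PiNat.mem_cylinder_iff.1 ht i (by omega)).symm

end Coding

/-- **Corollary 4.2.** For an odd prime `p` and `γ := -1/(2p) - 1/(4p²)`, if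
`|c - γ| < p` then the dynamics of `f_c(z) = z² + c` on its Julia set is topologically
conjugate to the shift map on the two-symbol sequence space; in particular `J(f_c)` is
compact. -/
theorem julia_of_nearby_quadratic_conjugate_to_shift
    {p : ℕ} [Fact (Nat.Prime p)] (hodd : p ≠ 2) {K : Type*} [NormedField K] [IsAlgClosed K]
    [CompleteSpace K] [IsUltrametricDist K] [Algebra ℚ_[p] K]
    (hext : ∀ q : ℚ_[p], ‖algebraMap ℚ_[p] K q‖ = ‖q‖)
    (γ : K) (hγ : γ = -(1 / (2 * (p : K))) - 1 / (4 * (p : K) ^ 2))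
    (c : K) (hc : ‖c - γ‖ < (p : ℝ)) :
    (∃ h : (julia (X ^ 2 + C c)) ≃ₜ (ℕ → Bool),
      ∀ (z : P1 K) (hz : z ∈ julia (X ^ 2 + C c)),
        ∃ hfz : polyMap (X ^ 2 + C c) z ∈ julia (X ^ 2 + C c),
          h ⟨polyMap (X ^ 2 + C c) z, hfz⟩ = shiftMap (h ⟨z, hz⟩)) ∧
    IsCompact (julia (X ^ 2 + C c)) := by
  have hp : p.Prime := Fact.out
  have hp1 : (1 : ℝ) < p := by exact_mod_cast hp.one_lt
  have hp0 : (0 : ℝ) < p := by linarith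
  have hnp : ‖(p : K)‖ = (p : ℝ)⁻¹ := by
    rw [← map_natCast (algebraMap ℚ_[p] K), hext, Padic.norm_p]
  have h2 : ‖(2 : K)‖ = 1 := by
    have h : ‖((2 : ℕ) : ℚ_[p])‖ = 1 :=
      Padic.norm_natCast_eq_one_iff.2 ((Nat.coprime_primes hp Nat.prime_two).2 hodd)
    rw [← hext, map_natCast] at h
    exact_mod_cast h
  have hpK : (p : K) ≠ 0 := norm_pos_iff.1 (by rw [hnp]; positivity)
  have h2K : (2 : K) ≠ 0 := norm_pos_iff.1 (by rw [h2]; exact one_pos)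
  have hγn : ‖γ‖ = (p : ℝ) ^ 2 := by
    have hγ' : γ = -((1 + 2 * (p : K)) / (2 * p) ^ 2) := by
      rw [hγ, show (4 : K) = 2 ^ 2 by norm_num]
      field_simp
      ring
    have hnum : ‖1 + 2 * (p : K)‖ = 1 := by
      rw [norm_add_eq_of_norm_lt, norm_one]
      rw [norm_mul, h2, one_mul, hnp, norm_one]
      exact inv_lt_one_of_one_lt₀ hp1
    rw [hγ', norm_neg, norm_div, hnum, norm_pow, norm_mul, h2, one_mul, hnp, inv_pow, one_div,
      inv_inv]
  have hcn : ‖c‖ = (p : ℝ) ^ 2 := by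
    rw [← hγn]
    refine norm_eq_of_norm_sub_lt (hc.trans ?_)
    rw [hγn]
    nlinarith
  obtain ⟨β, hβ⟩ := IsAlgClosed.exists_pow_nat_eq (-c) two_pos
  obtain rfl : c = -β ^ 2 := by rw [hβ, neg_neg]
  have hβn : ‖β‖ = p := by
    rw [norm_neg, norm_pow] at hcn
    exact (pow_left_inj₀ (norm_nonneg _) hp0.le two_ne_zero).1 hcn
  obtain ⟨h, hh⟩ := exists_homeomorph_itinerary hp1 hβn h2
  refine ⟨⟨h, fun x hx => ?_⟩, ?_⟩
  · have hfx : polyMap (X ^ 2 + C (-β ^ 2)) x ∈ julia (X ^ 2 + C (-β ^ 2)) := by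
      obtain ⟨z, rfl, hz⟩ := (mem_julia_quadratic_iff hp1 hcn h2).1 hx
      rw [polyMap_quadratic_toP1]
      exact toP1_mem_julia hp1 hcn h2 fun n => hz (n + 1)
    exact ⟨hfx, by rw [hh, hh, itinerary_polyMap]⟩
  · exact isCompact_iff_compactSpace.2 h.symm.compactSpace
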